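/- arXiv:2501.10399 — 3 statements merged into one kernel-verified Lean document; each statement's English description precedes it below -/
import Mathlib

section
/- For every real ε > 0 there exist a constant C > 0 and a threshold x₀ such that for every prime p ≥ x₀ there is an integer g with 2 ≤ g ≤ C · p^{1/2+ε} · log p that is simultaneously a primitive root modulo p and modulo p². Equivalently, the least stationary primitive root satisfies g_s(p) ≪ p^{1/2+ε} log p as p → ∞. -/
open Finset ArithmeticFunction
open scoped ArithmeticFunction.Moebius ArithmeticFunction.zeta

theorem sum_mulChar_add_mul_inv {F : Type*} [Field F] [Fintype F] [DecidableEq F]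
    {χ : MulChar F ℂ} (hχ : χ ≠ 1) (b c : F) :
    ∑ x, χ (x + b) * χ⁻¹ (x + c) = (if b = c then (Fintype.card F : ℂ) else 0) - 1 := by
  split_ifs with h
  · subst h
    have h1 : ∑ x, χ (x + b) * χ⁻¹ (x + b) = ∑ x : F, (1 : MulChar F ℂ) x := by
      rw [← Equiv.sum_comp (Equiv.addRight b) (fun x => (1 : MulChar F ℂ) x)]
      refine sum_congr rfl fun x _ => ?_
      rw [← MulChar.mul_apply, mul_inv_cancel]
      rfl
    rw [h1, MulChar.sum_one_eq_card_units, Fintype.card_units, Nat.cast_sub Fintype.card_pos]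
    simp
  · have hd : b - c ≠ 0 := sub_ne_zero.2 h
    have h2 := jacobiSum_nontrivial_inv hχ
    rw [jacobiSum] at h2
    let e : F ≃ F := (Equiv.mulLeft₀ (b - c) hd).trans (Equiv.addRight (-b))
    have h3 : ∀ y, χ (e y + b) * χ⁻¹ (e y + c) = χ (-1) * (χ y * χ⁻¹ (1 - y)) := by
      intro y
      have h4 : e y + b = (b - c) * y := by simp [e]
      have h5 : e y + c = (b - c) * ((-1) * (1 - y)) := by simp [e]; ring
      have h6 : χ (b - c) * χ⁻¹ (b - c) = 1 := by
        rw [← MulChar.mul_apply, mul_inv_cancel, MulChar.one_apply hd.isUnit]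
      have h7 : χ⁻¹ (-1) = χ (-1) := by rw [MulChar.inv_apply', inv_neg_one]
      rw [h4, h5, map_mul, map_mul, map_mul, h7]
      linear_combination (χ y * χ (-1) * χ⁻¹ (1 - y)) * h6
    rw [← Equiv.sum_comp e, sum_congr rfl fun y _ => h3 y, ← mul_sum, h2, mul_neg, ← map_mul]
    simp

/-- The second moment of a nontrivial multiplicative character over translates of a finite set. -/
theorem sum_norm_sq_sum_mulChar_add_le {F : Type*} [Field F] [Fintype F]
    {χ : MulChar F ℂ} (hχ : χ ≠ 1) (B : Finset F) :
    ∑ x, ‖∑ b ∈ B, χ (x + b)‖ ^ 2 ≤ Fintype.card F * (#B : ℝ) := by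
  classical
  have h : ((∑ x, ‖∑ b ∈ B, χ (x + b)‖ ^ 2 : ℝ) : ℂ)
      = ((Fintype.card F * (#B : ℝ) - (#B : ℝ) ^ 2 : ℝ) : ℂ) := by
    push_cast
    calc ∑ x, (‖∑ b ∈ B, χ (x + b)‖ : ℂ) ^ 2
        = ∑ x, ∑ b ∈ B, ∑ c ∈ B, χ (x + b) * χ⁻¹ (x + c) := by
          refine sum_congr rfl fun x _ => ?_
          rw [← Complex.mul_conj', map_sum, sum_mul_sum]
          refine sum_congr rfl fun b _ => sum_congr rfl fun c _ => ?_
          rw [← MulChar.star_apply']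
          rfl
      _ = ∑ b ∈ B, ∑ c ∈ B, ∑ x, χ (x + b) * χ⁻¹ (x + c) := by
          rw [sum_comm]
          exact sum_congr rfl fun b _ => sum_comm
      _ = _ := by
          simp_rw [sum_mulChar_add_mul_inv hχ, sum_sub_distrib, sum_ite_eq]
          simp
          ring
  have h' := Complex.ofReal_injective h
  rw [h']
  nlinarith [sq_nonneg (#B : ℝ)]

/-- A bilinear bound for the sum of a nontrivial multiplicative character over sums of
elements of two finite sets. -/
theorem norm_sum_sum_mulChar_add_le {F : Type*} [Field F] [Fintype F]
    {χ : MulChar F ℂ} (hχ : χ ≠ 1) (A B : Finset F) :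
    ‖∑ x ∈ A ×ˢ B, χ (x.1 + x.2)‖ ≤ √(Fintype.card F * (#A * #B)) := by
  apply Real.le_sqrt_of_sq_le
  rw [sum_product]
  calc ‖∑ a ∈ A, ∑ b ∈ B, χ (a + b)‖ ^ 2 ≤ (∑ a ∈ A, ‖∑ b ∈ B, χ (a + b)‖) ^ 2 := by
        gcongr
        exact norm_sum_le _ _
    _ ≤ #A * ∑ a ∈ A, ‖∑ b ∈ B, χ (a + b)‖ ^ 2 := sq_sum_le_card_mul_sum_sq
    _ ≤ #A * ∑ a, ‖∑ b ∈ B, χ (a + b)‖ ^ 2 := by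
        gcongr
        exact subset_univ _
    _ ≤ #A * (Fintype.card F * (#B : ℝ)) := by
        gcongr
        exact sum_norm_sq_sum_mulChar_add_le hχ B
    _ = _ := by ring

theorem exists_mulChar_orderOf_and_pow_eq_one_iff (F : Type*) [Field F] [Fintype F] :
    ∃ χ : MulChar F ℂ, orderOf χ = Fintype.card F - 1 ∧
      ∀ x : F, x ≠ 0 → ∀ k : ℕ, χ x ^ k = 1 ↔ x ^ k = 1 := by
  classical
  have hm : Fintype.card F - 1 ≠ 0 := by
    have := Fintype.one_lt_card (α := F)
    omega
  obtain ⟨χ, hχ⟩ := MulChar.exists_mulChar_orderOf F dvd_rfl (Complex.isPrimitiveRoot_exp _ hm)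
  refine ⟨χ, hχ, fun x hx k => ⟨fun h => ?_, fun h => by rw [← map_pow, h, map_one]⟩⟩
  obtain ⟨g, hg⟩ := IsCyclic.exists_monoid_generator (α := Fˣ)
  obtain ⟨i, hi⟩ := hg (Units.mk0 x hx)
  have hx' : x = (g : F) ^ i := by
    have := congrArg Units.val hi
    simpa using this.symm
  have hdvd : Fintype.card F - 1 ∣ i * k := by
    rw [← hχ]
    apply orderOf_dvd_of_pow_eq_one
    rw [MulChar.eq_iff (g := g) (fun y => (mem_powers_iff_mem_zpowers).1 (hg y)),
      MulChar.pow_apply_coe, MulChar.one_apply_coe, pow_mul, ← map_pow, ← hx', h]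
  rw [hx', ← pow_mul]
  obtain ⟨c, hc⟩ := hdvd
  rw [hc, pow_mul, FiniteField.pow_card_sub_one_eq_one _ g.ne_zero, one_pow]

/-- Sums from two finite sets are well distributed with respect to each subgroup of the
multiplicative group of a finite field. -/
theorem abs_card_add_pow_eq_one_sub_le {F : Type*} [Field F] [Fintype F] [DecidableEq F]
    {A B : Finset F} (hAB : ∀ a ∈ A, ∀ b ∈ B, a + b ≠ 0) {d : ℕ} (hd : d ∣ Fintype.card F - 1) :
    |(#{x ∈ A ×ˢ B | (x.1 + x.2) ^ ((Fintype.card F - 1) / d) = 1} : ℝ) - #A * #B / d|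
      ≤ √(Fintype.card F * (#A * #B)) := by
  obtain ⟨χ, hχ, hχ1⟩ := exists_mulChar_orderOf_and_pow_eq_one_iff F
  set m := Fintype.card F - 1 with hm_def
  have hm : 0 < m := by
    have := Fintype.one_lt_card (α := F)
    omega
  have hd0 : 0 < d := Nat.pos_of_dvd_of_pos hd hm
  have hind : ∀ x : F, x ≠ 0 →
      ∑ j ∈ range d, (χ ^ (m / d * j)) x = if x ^ (m / d) = 1 then (d : ℂ) else 0 := by
    intro x hx
    have h1 : ∀ j, (χ ^ (m / d * j)) x = (χ x ^ (m / d)) ^ j := by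
      intro j
      rw [← pow_mul]
      exact MulChar.pow_apply_coe χ _ (Units.mk0 x hx)
    simp_rw [h1]
    split_ifs with h
    · rw [(hχ1 x hx _).2 h]
      simp
    · rw [geom_sum_eq (mt (hχ1 x hx _).1 h), ← pow_mul, Nat.div_mul_cancel hd,
        (hχ1 x hx m).2 (FiniteField.pow_card_sub_one_eq_one x hx)]
      simp
  set N := #{x ∈ A ×ˢ B | (x.1 + x.2) ^ (m / d) = 1} with hN
  have hsum : (d : ℂ) * N
      = ∑ j ∈ range d, ∑ x ∈ A ×ˢ B, (χ ^ (m / d * j)) (x.1 + x.2) := by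
    rw [sum_comm, sum_congr rfl fun x hx =>
      hind _ (hAB _ (mem_product.1 hx).1 _ (mem_product.1 hx).2), ← sum_filter, sum_const,
      nsmul_eq_mul, mul_comm]
  obtain ⟨k, rfl⟩ : ∃ k, d = k + 1 := ⟨d - 1, by omega⟩
  rw [sum_range_succ'] at hsum
  have hmain : ∑ x ∈ A ×ˢ B, (χ ^ (m / (k + 1) * 0)) (x.1 + x.2) = (#A * #B : ℂ) := by
    rw [sum_congr rfl (g := fun _ => (1 : ℂ)) fun x hx => ?_]
    · simp
    · rw [mul_zero, pow_zero, MulChar.one_apply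
        (hAB _ (mem_product.1 hx).1 _ (mem_product.1 hx).2).isUnit]
  rw [hmain] at hsum
  set E := √(Fintype.card F * (#A * #B) : ℝ)
  have herr : ‖((k + 1 : ℕ) * (N : ℂ)) - #A * #B‖ ≤ (k + 1 : ℕ) * E := by
    rw [hsum, add_sub_cancel_right]
    refine (norm_sum_le _ _).trans ?_
    calc _ ≤ ∑ j ∈ range k, E := by
          refine sum_le_sum fun j hj => norm_sum_sum_mulChar_add_le ?_ A B
          refine pow_ne_one_of_lt_orderOf (Nat.mul_ne_zero ?_ (by omega)) ?_
          · exact (Nat.div_pos (Nat.le_of_dvd hm hd) hd0).ne'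
          · rw [hχ]
            calc m / (k + 1) * (j + 1) < m / (k + 1) * (k + 1) := by
                  apply Nat.mul_lt_mul_of_pos_left _ (Nat.div_pos (Nat.le_of_dvd hm hd) hd0)
                  have := mem_range.1 hj
                  omega
              _ = m := Nat.div_mul_cancel hd
      _ = k * E := by simp
      _ ≤ _ := by
          gcongr
          omega
  have hd' : (0 : ℝ) < (k + 1 : ℕ) := by positivity
  have hreal : ‖((k + 1 : ℕ) * (N : ℂ)) - #A * #B‖
      = (k + 1 : ℕ) * |(N : ℝ) - #A * #B / (k + 1 : ℕ)| := by
    rw [← abs_of_pos hd', ← abs_mul, abs_of_pos hd', mul_sub, mul_div_cancel₀ _ hd'.ne',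
      ← Real.norm_eq_abs, ← Complex.norm_real]
    push_cast
    rfl
  rw [hreal] at herr
  exact le_of_mul_le_mul_left herr hd'

theorem sum_moebius_div_eq_totient_div {m : ℕ} (hm : 0 < m) :
    ∑ d ∈ m.divisors, (μ d : ℝ) / d = m.totient / m := by
  have h := (sum_eq_iff_sum_mul_moebius_eq (R := ℝ) (f := fun n => (n.totient : ℝ))
    (g := fun n => (n : ℝ))).1 (fun n _ => by rw [← Nat.cast_sum, Nat.sum_totient]) m hm
  rw [Nat.sum_divisorsAntidiagonal (fun a b => (μ a : ℝ) * (b : ℝ))] at h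
  rw [← h, sum_div]
  refine sum_congr rfl fun d hd => ?_
  have hdm := (Nat.mem_divisors.1 hd).1
  have hd0 : (d : ℝ) ≠ 0 := by
    exact_mod_cast (Nat.pos_of_dvd_of_pos hdm hm).ne'
  have hm0 : (m : ℝ) ≠ 0 := by exact_mod_cast hm.ne'
  rw [Nat.cast_div hdm hd0]
  field_simp

theorem sum_moebius_pow_div_eq_one {G : Type*} [Monoid G] [DecidableEq G] {x : G} {m : ℕ}
    (hm : 0 < m) (hx : x ^ m = 1) :
    ∑ d ∈ m.divisors, (if x ^ (m / d) = 1 then (μ d : ℝ) else 0)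
      = if orderOf x = m then 1 else 0 := by
  have hord : orderOf x ∣ m := orderOf_dvd_of_pow_eq_one hx
  have h0 : 0 < orderOf x := Nat.pos_of_dvd_of_pos hord hm
  rw [← sum_filter]
  have hset : {d ∈ m.divisors | x ^ (m / d) = 1} = (m / orderOf x).divisors := by
    ext d
    simp only [mem_filter, Nat.mem_divisors, ← orderOf_dvd_iff_pow_eq_one]
    constructor
    · rintro ⟨⟨h1, -⟩, h2⟩
      refine ⟨?_, (Nat.div_pos (Nat.le_of_dvd hm hord) h0).ne'⟩
      rw [Nat.dvd_div_iff_mul_dvd hord, mul_comm]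
      exact (Nat.dvd_div_iff_mul_dvd h1).1 h2
    · rintro ⟨h1, -⟩
      have h3 := (Nat.dvd_div_iff_mul_dvd hord).1 h1
      have h4 : d ∣ m := (dvd_mul_left _ _).trans h3
      refine ⟨⟨h4, hm.ne'⟩, ?_⟩
      rw [Nat.dvd_div_iff_mul_dvd h4, mul_comm]
      exact h3
  have hone : ((μ : ArithmeticFunction ℤ) : ArithmeticFunction ℝ) * (ζ : ArithmeticFunction ℝ) = 1 :=
    coe_moebius_mul_coe_zeta
  have happ := congrArg (fun f : ArithmeticFunction ℝ => f (m / orderOf x)) hone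
  simp only [coe_mul_zeta_apply, intCoe_apply, one_apply] at happ
  rw [hset, happ]
  refine if_congr ?_ rfl rfl
  rw [Nat.div_eq_iff_eq_mul_left h0 hord, one_mul, eq_comm]

/-- A lower bound for the number of sums from two finite sets that generate the
multiplicative group of a finite field. -/
theorem le_card_add_orderOf_eq {F : Type*} [Field F] [Fintype F] [DecidableEq F]
    {A B : Finset F} (hAB : ∀ a ∈ A, ∀ b ∈ B, a + b ≠ 0) :
    (#A * #B : ℝ) / #(Fintype.card F - 1).divisors
        - #(Fintype.card F - 1).divisors * √(Fintype.card F * (#A * #B))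
      ≤ #{x ∈ A ×ˢ B | orderOf (x.1 + x.2) = Fintype.card F - 1} := by
  set m := Fintype.card F - 1 with hm_def
  have hm : 0 < m := by
    have := Fintype.one_lt_card (α := F)
    omega
  set E := √(Fintype.card F * (#A * #B) : ℝ)
  have h1 : (#{x ∈ A ×ˢ B | orderOf (x.1 + x.2) = m} : ℝ)
      = ∑ d ∈ m.divisors, (μ d : ℝ) * #{x ∈ A ×ˢ B | (x.1 + x.2) ^ (m / d) = 1} := by
    rw [card_filter, Nat.cast_sum]
    calc _ = ∑ x ∈ A ×ˢ B, ∑ d ∈ m.divisors,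
          (if (x.1 + x.2) ^ (m / d) = 1 then (μ d : ℝ) else 0) := by
          refine sum_congr rfl fun x hx => ?_
          rw [sum_moebius_pow_div_eq_one hm (FiniteField.pow_card_sub_one_eq_one _
            (hAB _ (mem_product.1 hx).1 _ (mem_product.1 hx).2))]
          push_cast
          rfl
      _ = _ := by
          rw [sum_comm]
          refine sum_congr rfl fun d _ => ?_
          rw [← sum_filter, sum_const, nsmul_eq_mul, mul_comm]
  have h2 : |(#{x ∈ A ×ˢ B | orderOf (x.1 + x.2) = m} : ℝ) - #A * #B * (m.totient / m)|
      ≤ #m.divisors * E := by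
    rw [h1, ← sum_moebius_div_eq_totient_div hm, mul_sum, ← sum_sub_distrib]
    refine (abs_sum_le_sum_abs _ _).trans ?_
    refine (sum_le_card_nsmul _ _ E fun d hd => ?_).trans_eq (nsmul_eq_mul _ _)
    have h3 := abs_card_add_pow_eq_one_sub_le hAB (Nat.mem_divisors.1 hd).1
    have h4 : |(μ d : ℝ)| ≤ 1 := by exact_mod_cast abs_moebius_le_one (n := d)
    calc _ = |(μ d : ℝ)| * |(#{x ∈ A ×ˢ B | (x.1 + x.2) ^ (m / d) = 1} : ℝ) - #A * #B / d| := by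
          rw [← abs_mul]
          congr 1
          ring
      _ ≤ 1 * E := by gcongr
      _ = E := one_mul E
  have h5 : (1 : ℝ) / #m.divisors ≤ m.totient / m := by
    have hτ : 0 < #m.divisors := card_pos.2 ⟨1, by simp [hm.ne']⟩
    rw [div_le_div_iff₀ (by exact_mod_cast hτ) (by exact_mod_cast hm), one_mul]
    have : m ≤ #m.divisors * m.totient := by
      conv_lhs => rw [← Nat.sum_totient m]
      rw [← smul_eq_mul]
      refine sum_le_card_nsmul _ _ _ fun d hd => ?_
      exact Nat.le_of_dvd (Nat.totient_pos.2 hm)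
        (Nat.totient_dvd_of_dvd (Nat.mem_divisors.1 hd).1)
    rw [mul_comm]
    exact_mod_cast this
  have h6 : (#A * #B : ℝ) * (1 / #m.divisors) ≤ #A * #B * (m.totient / m) := by gcongr
  rw [mul_one_div] at h6
  linarith [(abs_le.1 h2).1]

/-- The divisor bound. -/
theorem exists_card_divisors_le_mul_rpow {ε : ℝ} (hε : 0 < ε) :
    ∃ C : ℝ, 1 ≤ C ∧ ∀ n : ℕ, n ≠ 0 → (#n.divisors : ℝ) ≤ C * (n : ℝ) ^ ε := by
  have hlog : 0 < Real.log 2 := Real.log_pos one_lt_two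
  set M : ℝ := max 1 (1 / (ε * Real.log 2)) with hM
  have hM1 : 1 ≤ M := le_max_left _ _
  have hMε : 1 ≤ M * (ε * Real.log 2) := by
    rw [← div_le_iff₀ (by positivity)]
    exact le_max_right _ _
  obtain ⟨K, hK⟩ := exists_nat_ge ((2 : ℝ) ^ (1 / ε))
  have key : ∀ q : ℕ, 2 ≤ q → ∀ e : ℕ,
      ((e : ℝ) + 1) ≤ (if q < K then M else 1) * ((q : ℝ) ^ e) ^ ε := by
    intro q hq e
    have hq2 : (2 : ℝ) ≤ q := by exact_mod_cast hq
    split_ifs with h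
    · calc (e : ℝ) + 1 ≤ M * (Real.log 2 * (e * ε) + 1) := by
            nlinarith [mul_le_mul_of_nonneg_right hMε (Nat.cast_nonneg (α := ℝ) e)]
        _ ≤ M * Real.exp (Real.log 2 * (e * ε)) := by
            gcongr
            exact Real.add_one_le_exp _
        _ = M * ((2 : ℝ) ^ e) ^ ε := by
            rw [← Real.rpow_natCast, ← Real.rpow_mul zero_le_two,
              Real.rpow_def_of_pos zero_lt_two]
        _ ≤ _ := by gcongr
    · have hKq : (K : ℝ) ≤ q := by exact_mod_cast not_lt.1 h
      have h2 : (2 : ℝ) ≤ (q : ℝ) ^ ε := by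
        calc (2 : ℝ) = ((2 : ℝ) ^ (1 / ε)) ^ ε := by
              rw [← Real.rpow_mul zero_le_two, one_div_mul_cancel hε.ne', Real.rpow_one]
          _ ≤ _ := by
              gcongr
              exact hK.trans hKq
      rw [one_mul, ← Real.rpow_pow_comm (by positivity)]
      calc (e : ℝ) + 1 ≤ (2 : ℝ) ^ e := by exact_mod_cast e.lt_two_pow_self
        _ ≤ _ := by gcongr
  refine ⟨M ^ K, one_le_pow₀ hM1, fun n hn => ?_⟩
  rw [Nat.card_divisors hn]
  have hn' : (n : ℝ) ^ ε = ∏ q ∈ n.primeFactors, ((q : ℝ) ^ (n.factorization q)) ^ ε := by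
    rw [Real.finsetProd_rpow _ _ fun q _ => by positivity]
    congr 1
    conv_lhs => rw [← Nat.prod_factorization_pow_eq_self hn]
    rw [Finsupp.prod, Nat.support_factorization]
    push_cast
    rfl
  rw [hn']
  push_cast
  calc ∏ q ∈ n.primeFactors, ((n.factorization q : ℝ) + 1)
      ≤ ∏ q ∈ n.primeFactors, ((if q < K then M else 1) * ((q : ℝ) ^ (n.factorization q)) ^ ε) :=
        prod_le_prod (fun q _ => by positivity) fun q hq =>
          key q (Nat.prime_of_mem_primeFactors hq).two_le _
    _ = M ^ #{q ∈ n.primeFactors | q < K}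
          * ∏ q ∈ n.primeFactors, ((q : ℝ) ^ (n.factorization q)) ^ ε := by
        rw [prod_mul_distrib, ← prod_filter, prod_const]
    _ ≤ _ := by
        refine mul_le_mul_of_nonneg_right (pow_le_pow_right₀ hM1 ?_)
          (prod_nonneg fun q _ => by positivity)
        calc #{q ∈ n.primeFactors | q < K} ≤ #(range K) :=
              card_le_card fun q hq => mem_range.2 (mem_filter.1 hq).2
          _ = K := card_range K

/-- Few small integers lie in the subgroup of order `p - 1` modulo `p ^ 2`. -/
theorem sq_card_pow_sub_one_eq_one_le {p : ℕ} (hp : p.Prime) (hp2 : p ≠ 2) {N T : ℕ} (hN : N < p)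
    (hT : ∀ n ∈ Icc 1 (N ^ 2), #n.divisors ≤ T) :
    #((Icc 1 N).filter fun n : ℕ => (n : ZMod (p ^ 2)) ^ (p - 1) = 1) ^ 2 ≤ T * (p - 1) := by
  set S := (Icc 1 N).filter fun n : ℕ => (n : ZMod (p ^ 2)) ^ (p - 1) = 1 with hS
  have hp0 : p - 1 ≠ 0 := by
    have := hp.two_le
    omega
  have : NeZero (p ^ 2) := ⟨pow_ne_zero 2 hp.ne_zero⟩
  have hcyc := ZMod.isCyclic_units_of_prime_pow p hp hp2 2
  have hmem : ∀ k ∈ (S ×ˢ S).image (fun x => x.1 * x.2),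
      k ∈ Icc 1 (N ^ 2) ∧ (k : ZMod (p ^ 2)) ^ (p - 1) = 1 := by
    intro k hk
    obtain ⟨⟨a, b⟩, hab, rfl⟩ := mem_image.1 hk
    simp only [hS, mem_product, mem_filter, mem_Icc] at hab
    obtain ⟨⟨⟨ha1, haN⟩, ha⟩, ⟨hb1, hbN⟩, hb⟩ := hab
    refine ⟨mem_Icc.2 ⟨Nat.mul_pos ha1 hb1, ?_⟩, ?_⟩
    · rw [sq]
      exact Nat.mul_le_mul haN hbN
    · push_cast
      rw [mul_pow, ha, hb, one_mul]
  have hfib := card_le_mul_card_image (f := fun x : ℕ × ℕ => x.1 * x.2) (S ×ˢ S) T ?_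
  · rw [card_product, ← sq] at hfib
    refine hfib.trans (Nat.mul_le_mul_left _ ?_)
    refine le_trans ?_ (IsCyclic.card_pow_eq_one_le (α := (ZMod (p ^ 2))ˣ)
      (Nat.pos_of_ne_zero hp0))
    refine card_le_card_of_surjOn (fun u => (u : ZMod (p ^ 2)).val) fun k hk => ?_
    obtain ⟨hk1, hk2⟩ := hmem k hk
    refine ⟨Units.ofPowEqOne _ _ hk2 hp0, ?_, ?_⟩
    · simp
    · simp only [Units.val_ofPowEqOne]
      exact ZMod.val_cast_of_lt ((mem_Icc.1 hk1).2.trans_lt (Nat.pow_lt_pow_left hN two_ne_zero))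
  · intro k hk
    obtain ⟨hk1, -⟩ := hmem k hk
    refine le_trans ?_ (hT k hk1)
    refine card_le_card_of_injOn Prod.fst ?_ ?_
    · rintro ⟨a, b⟩ hab
      have hab' := (mem_filter.1 hab).2
      have := (mem_Icc.1 hk1).1
      simp only at hab'
      exact Nat.mem_divisors.2 ⟨⟨b, hab'.symm⟩, by omega⟩
    · rintro ⟨a, b⟩ hab ⟨a', b'⟩ hab' h
      simp only at h
      subst h
      have h1 := (mem_filter.1 hab).2
      have h2 := (mem_filter.1 hab').2
      have h3 := (mem_Icc.1 hk1).1
      simp only at h1 h2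
      have ha : 0 < a := Nat.pos_of_ne_zero (by rintro rfl; omega)
      rw [Nat.eq_of_mul_eq_mul_left ha (h1.trans h2.symm)]

theorem orderOf_natCast_sq_eq_totient {p g : ℕ} (hp : p.Prime) (hg : orderOf (g : ZMod p) = p - 1)
    (hg2 : (g : ZMod (p ^ 2)) ^ (p - 1) ≠ 1) :
    orderOf (g : ZMod (p ^ 2)) = (p ^ 2).totient := by
  have hp0 : 0 < p - 1 := by
    have := hp.two_le
    omega
  have htot : (p ^ 2).totient = p * (p - 1) := by
    rw [Nat.totient_prime_pow hp two_pos]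
    simp
  have hcop : g.Coprime (p ^ 2) := by
    apply Nat.Coprime.pow_right
    rw [← ZMod.isUnit_iff_coprime]
    refine IsUnit.of_pow_eq_one (n := p - 1) ?_ hp0.ne'
    rw [← hg, pow_orderOf_eq_one]
  have h1 : p - 1 ∣ orderOf (g : ZMod (p ^ 2)) := by
    rw [← hg]
    have := orderOf_map_dvd (ZMod.castHom (dvd_pow_self p two_ne_zero) (ZMod p)).toMonoidHom
      (g : ZMod (p ^ 2))
    simpa using this
  have h2 : orderOf (g : ZMod (p ^ 2)) ∣ p * (p - 1) := by
    rw [← htot]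
    apply orderOf_dvd_of_pow_eq_one
    have := ZMod.pow_totient (ZMod.unitOfCoprime g hcop)
    rw [← ZMod.coe_unitOfCoprime g hcop, ← Units.val_pow_eq_pow_val, this, Units.val_one]
  obtain ⟨c, hc⟩ := h1
  rw [htot]
  rw [hc, mul_comm p] at h2
  rcases (Nat.dvd_prime hp).1 (Nat.dvd_of_mul_dvd_mul_left hp0 h2) with rfl | rfl
  · rw [mul_one] at hc
    exact absurd (hc ▸ pow_orderOf_eq_one (g : ZMod (p ^ 2))) hg2
  · rw [hc, mul_comm]

/-- A criterion for the existence of a small stationary primitive root in terms of the divisor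
function. -/
theorem exists_stationary_primitive_root_le {p : ℕ} (hp : p.Prime) (hp2 : p ≠ 2) {H T : ℕ}
    (hH : 2 * H < p) (hT : ∀ n ∈ Icc 1 ((2 * H) ^ 2), #n.divisors ≤ T)
    (hlt : (#(p - 1).divisors : ℝ) ^ 2 * √p + #(p - 1).divisors * √(T * p) < H) :
    ∃ g : ℕ, 2 ≤ g ∧ g ≤ 2 * H ∧ orderOf (g : ZMod p) = p.totient ∧
      orderOf (g : ZMod (p ^ 2)) = (p ^ 2).totient := by
  by_contra! hcon
  have : Fact p.Prime := ⟨hp⟩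
  rw [Nat.totient_prime hp] at hcon
  have hinj : Set.InjOn (fun n : ℕ => (n : ZMod p)) (Icc 1 H) := by
    intro a ha b hb hab
    simp only [coe_Icc, Set.mem_Icc] at ha hb
    exact Nat.ModEq.eq_of_lt_of_lt ((ZMod.natCast_eq_natCast_iff _ _ _).1 hab)
      (by omega) (by omega)
  set A : Finset (ZMod p) := (Icc 1 H).image (fun n : ℕ => (n : ZMod p)) with hA
  have hAcard : #A = H := by
    rw [hA, card_image_of_injOn hinj]
    simp
  have hAval : ∀ a ∈ A, 1 ≤ a.val ∧ a.val ≤ H := by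
    intro a ha
    obtain ⟨n, hn, rfl⟩ := mem_image.1 ha
    have hn' := mem_Icc.1 hn
    rw [ZMod.val_cast_of_lt (by omega)]
    exact hn'
  have hsum : ∀ a b : ZMod p, ((a.val + b.val : ℕ) : ZMod p) = a + b := by simp
  have hA0 : ∀ a ∈ A, ∀ b ∈ A, a + b ≠ 0 := by
    intro a ha b hb h
    rw [← hsum, ZMod.natCast_eq_zero_iff] at h
    have h1 := hAval a ha
    have h2 := hAval b hb
    have := Nat.le_of_dvd (by omega) h
    omega
  have hlow := le_card_add_orderOf_eq hA0
  rw [hAcard, ZMod.card] at hlow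
  set S := (Icc 1 (2 * H)).filter fun n : ℕ => (n : ZMod (p ^ 2)) ^ (p - 1) = 1 with hS
  have hS2 := sq_card_pow_sub_one_eq_one_le hp hp2 hH hT
  rw [← hS] at hS2
  have hup : #{x ∈ A ×ˢ A | orderOf (x.1 + x.2) = p - 1} ≤ H * #S := by
    rw [← hAcard, ← card_product]
    refine card_le_card_of_injOn (fun x => (x.1, x.1.val + x.2.val)) ?_ ?_
    · rintro ⟨a, b⟩ hx
      obtain ⟨hab, hord⟩ := mem_filter.1 hx
      obtain ⟨ha, hb⟩ := mem_product.1 hab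
      have h1 := hAval a ha
      have h2 := hAval b hb
      simp only at h1 h2 hord
      have hmem : a.val + b.val ∈ Icc 1 (2 * H) := mem_Icc.2 ⟨by omega, by omega⟩
      refine mem_product.2 ⟨ha, mem_filter.2 ⟨hmem, ?_⟩⟩
      by_contra hne
      rw [← hsum] at hord
      exact hcon _ (by omega) (by omega) hord (orderOf_natCast_sq_eq_totient hp hord hne)
    · rintro ⟨a, b⟩ - ⟨a', b'⟩ - h
      simp only [Prod.mk.injEq] at h
      obtain ⟨rfl, h⟩ := h
      rw [ZMod.val_injective p (by omega : b.val = b'.val)]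
  have hSle : (#S : ℝ) ≤ √(T * p) := by
    apply Real.le_sqrt_of_sq_le
    have : #S ^ 2 ≤ T * p := hS2.trans (Nat.mul_le_mul_left _ (Nat.sub_le p 1))
    exact_mod_cast this
  have hup' : (#{x ∈ A ×ˢ A | orderOf (x.1 + x.2) = p - 1} : ℝ) ≤ H * √(T * p) :=
    (by exact_mod_cast hup : (_ : ℝ) ≤ H * #S).trans (by gcongr)
  have hsqrt : √(p * (H * H) : ℝ) = √p * H := by
    rw [Real.sqrt_mul (Nat.cast_nonneg p), Real.sqrt_mul_self (Nat.cast_nonneg H)]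
  rw [hsqrt] at hlow
  set τ : ℝ := (#(p - 1).divisors : ℝ) with hτ_def
  have hτ : 0 < τ := by
    have : 0 < #(p - 1).divisors := card_pos.2 ⟨1, by
      have := hp.two_le
      simp
      omega⟩
    rw [hτ_def]
    exact_mod_cast this
  have hH0 : (0 : ℝ) < H := lt_of_le_of_lt (by positivity) hlt
  have h1 := hlow.trans hup'
  have h2 : (H : ℝ) * H ≤ (H * √(T * p) + τ * (√p * H)) * τ := by
    rw [← div_le_iff₀ hτ]
    linarith
  have h3 : (H : ℝ) * H ≤ H * (τ ^ 2 * √p + τ * √(T * p)) := by linarith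
  exact absurd (le_of_mul_le_mul_left h3 hH0) (not_le.2 hlt)

/-- For every real `ε > 0` there exist a constant `C > 0` and a threshold
`x₀` such that every prime `p ≥ x₀` admits an integer `g` with
`2 ≤ g ≤ C · p^(1/2+ε) · log p` that is simultaneously a primitive root modulo `p`
and modulo `p²` (a stationary primitive root). -/
theorem least_stationary_primitive_root_bound :
    ∀ ε : ℝ, 0 < ε →
      ∃ C : ℝ, 0 < C ∧ ∃ x₀ : ℝ, ∀ p : ℕ, p.Prime → x₀ ≤ (p : ℝ) →
        ∃ g : ℕ, 2 ≤ g ∧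
          (g : ℝ) ≤ C * (p : ℝ) ^ ((1 : ℝ) / 2 + ε) * Real.log p ∧
          orderOf ((g : ZMod p)) = Nat.totient p ∧
          orderOf ((g : ZMod (p ^ 2))) = Nat.totient (p ^ 2) := by
  intro ε hε
  set δ : ℝ := min ε (1 / 4) with hδ_def
  have hδ : 0 < δ := lt_min hε (by norm_num)
  have hδε : δ ≤ ε := min_le_left _ _
  have hδ4 : δ ≤ 1 / 4 := min_le_right _ _
  obtain ⟨C, hC1, hC⟩ := exists_card_divisors_le_mul_rpow (ε := δ / 4) (by positivity)
  have hev : ∀ᶠ x : ℝ in Filter.atTop, 3 ≤ x ∧ 4 < x ^ (1 / 2 - δ) ∧ 2 * C ^ 2 < x ^ (δ / 2) :=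
    (Filter.eventually_ge_atTop 3).and
      (((tendsto_rpow_atTop (by linarith)).eventually_gt_atTop 4).and
        ((tendsto_rpow_atTop (by positivity)).eventually_gt_atTop (2 * C ^ 2)))
  obtain ⟨x₀, hx₀⟩ := Filter.eventually_atTop.1 hev
  refine ⟨4, by norm_num, x₀, fun p hp hpx => ?_⟩
  obtain ⟨hp3, hp4, hpC⟩ := hx₀ p hpx
  have hp0 : (0 : ℝ) < p := by linarith
  have hp3' : 3 ≤ p := by exact_mod_cast hp3
  set H := ⌈(p : ℝ) ^ (1 / 2 + δ)⌉₊ with hH_def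
  have hHge : (p : ℝ) ^ (1 / 2 + δ) ≤ H := Nat.le_ceil _
  have hHle : (2 * H : ℝ) ≤ 4 * (p : ℝ) ^ (1 / 2 + δ) := by
    have h1 : (H : ℝ) < (p : ℝ) ^ (1 / 2 + δ) + 1 := Nat.ceil_lt_add_one (by positivity)
    have h2 : (1 : ℝ) ≤ (p : ℝ) ^ (1 / 2 + δ) := Real.one_le_rpow (by linarith) (by linarith)
    linarith
  have hHp : 2 * H < p := by
    have h1 : (2 * H : ℝ) < p := by
      calc (2 * H : ℝ) ≤ 4 * (p : ℝ) ^ (1 / 2 + δ) := hHle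
        _ < (p : ℝ) ^ (1 / 2 - δ) * (p : ℝ) ^ (1 / 2 + δ) := by gcongr
        _ = p := by
            rw [← Real.rpow_add hp0]
            norm_num
    exact_mod_cast h1
  set P : ℝ := (p : ℝ) ^ (δ / 4) with hP
  have hP0 : 0 < P := by positivity
  have hP2 : P ^ 2 = (p : ℝ) ^ (δ / 2) := by
    rw [hP, ← Real.rpow_natCast, ← Real.rpow_mul hp0.le]
    congr 1
    push_cast
    ring
  have hτ : (#(p - 1).divisors : ℝ) ≤ C * P := by
    refine (hC (p - 1) (by omega)).trans ?_
    rw [hP]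
    gcongr
    exact Nat.sub_le p 1
  have hTdiv : ∀ n ∈ Icc 1 ((2 * H) ^ 2), #n.divisors ≤ ⌊C * P ^ 2⌋₊ := by
    intro n hn
    obtain ⟨hn1, hn2⟩ := mem_Icc.1 hn
    apply Nat.le_floor
    refine (hC n (by omega)).trans ?_
    have h1 : (n : ℝ) ≤ (p : ℝ) ^ 2 := by
      exact_mod_cast hn2.trans (Nat.pow_le_pow_left hHp.le 2)
    rw [hP, Real.rpow_pow_comm hp0.le]
    gcongr
  have hroot : √(⌊C * P ^ 2⌋₊ * p : ℝ) ≤ C * P * √p := by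
    rw [Real.sqrt_mul (Nat.cast_nonneg _)]
    gcongr
    apply Real.sqrt_le_iff.2 ⟨by positivity, ?_⟩
    refine (Nat.floor_le (by positivity)).trans ?_
    rw [mul_pow]
    gcongr
    exact le_self_pow₀ hC1 two_ne_zero
  obtain ⟨g, hg2, hgH, hg⟩ := exists_stationary_primitive_root_le hp (by omega) hHp hTdiv (by
    calc _ ≤ (C * P) ^ 2 * √p + C * P * (C * P * √p) := by gcongr
      _ = 2 * C ^ 2 * P ^ 2 * √p := by ring
      _ < P ^ 2 * P ^ 2 * √p := by
          rw [← hP2] at hpC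
          gcongr
      _ = (p : ℝ) ^ (1 / 2 + δ) := by
          rw [hP2, Real.sqrt_eq_rpow, ← Real.rpow_add hp0, ← Real.rpow_add hp0]
          congr 1
          ring
      _ ≤ H := hHge)
  refine ⟨g, hg2, ?_, hg⟩
  have hlog : 1 ≤ Real.log p := by
    rw [Real.le_log_iff_exp_le hp0]
    exact Real.exp_one_lt_three.le.trans hp3
  calc (g : ℝ) ≤ 2 * H := by exact_mod_cast hgH
    _ ≤ 4 * (p : ℝ) ^ (1 / 2 + δ) := hHle
    _ ≤ 4 * (p : ℝ) ^ (1 / 2 + ε) := by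
        gcongr
        linarith
    _ ≤ 4 * (p : ℝ) ^ (1 / 2 + ε) * Real.log p := le_mul_of_one_le_right (by positivity) hlog
end

section
/- Let p be an odd prime, let τ ∈ {1, …, p−1} be a primitive root modulo p, and let h ∈ {1, …, p−1} be the inverse of τ modulo p, i.e. τ·h ≡ 1 (mod p). Then either τ is a primitive root modulo p^k for every integer k ≥ 1, or h is a primitive root modulo p^k for every integer k ≥ 1. -/
/-- A primitive root `g` modulo an odd prime `p` with `g ^ (p - 1) ≠ 1` modulo `p ^ 2` is a
primitive root modulo every positive power of `p`. -/
theorem orderOf_natCast_prime_pow_eq_totient {p g : ℕ} (hp : p.Prime) (hp2 : p ≠ 2)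
    (hg : orderOf (g : ZMod p) = p - 1) (hg2 : (g : ZMod (p ^ 2)) ^ (p - 1) ≠ 1)
    {k : ℕ} (hk : 1 ≤ k) : orderOf (g : ZMod (p ^ k)) = Nat.totient (p ^ k) := by
  obtain ⟨n, rfl⟩ := Nat.exists_eq_add_of_le' hk
  obtain ⟨a, ha⟩ : (p : ℤ) ∣ (g : ℤ) ^ (p - 1) - 1 := by
    rw [← ZMod.intCast_zmod_eq_zero_iff_dvd]
    push_cast
    rw [← hg, pow_orderOf_eq_one, sub_self]
  have hpa : ¬ (p : ℤ) ∣ a := by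
    rintro ⟨b, rfl⟩
    refine hg2 (sub_eq_zero.mp ?_)
    have h : (((g : ℤ) ^ (p - 1) - 1 : ℤ) : ZMod (p ^ 2)) = 0 := by
      rw [ZMod.intCast_zmod_eq_zero_iff_dvd, ha]
      exact ⟨b, by push_cast; ring⟩
    exact_mod_cast h
  have hpow : (g : ZMod (p ^ (n + 1))) ^ (p - 1) = 1 + p * a := by
    have h := congrArg (Int.cast : ℤ → ZMod (p ^ (n + 1))) (sub_eq_iff_eq_add'.mp ha)
    exact_mod_cast h
  have hdvd : p - 1 ∣ orderOf (g : ZMod (p ^ (n + 1))) := by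
    have h := orderOf_map_dvd
      (ZMod.castHom (dvd_pow_self p n.succ_ne_zero) (ZMod p)).toMonoidHom
      (g : ZMod (p ^ (n + 1)))
    simpa [hg] using h
  have hord := ZMod.orderOf_one_add_mul_prime hp hp2 a hpa n
  rw [← hpow, orderOf_pow_of_dvd (Nat.sub_ne_zero_of_lt hp.one_lt) hdvd] at hord
  rw [Nat.totient_prime_pow_succ hp, ← hord, Nat.div_mul_cancel hdvd]

/-- In a commutative monoid, mutually inverse elements have the same order. -/
theorem orderOf_eq_of_mul_eq_one {M : Type*} [CommMonoid M] {x y : M} (hxy : x * y = 1) :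
    orderOf x = orderOf y := by
  refine orderOf_eq_orderOf_iff.mpr fun n ↦ ?_
  have h : x ^ n * y ^ n = 1 := by rw [← mul_pow, hxy, one_pow]
  constructor <;> intro h1 <;> simpa [h1] using h


/-- Let `p` be an odd prime, `τ ∈ {1,…,p−1}` a primitive root modulo
`p`, and `h ∈ {1,…,p−1}` the inverse of `τ` modulo `p`. Then either `τ` is a primitive
root modulo `p^k` for every `k ≥ 1`, or `h` is a primitive root modulo `p^k` for every
`k ≥ 1`. -/
theorem primitive_root_or_inverse_lifts (p : ℕ) (hp : p.Prime) (hp2 : p ≠ 2)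
    (τ h : ℕ) (hτ1 : 1 ≤ τ) (hτ2 : τ ≤ p - 1) (hh1 : 1 ≤ h) (hh2 : h ≤ p - 1)
    (hinv : τ * h ≡ 1 [MOD p])
    (hτ : orderOf ((τ : ZMod p)) = p - 1) :
    (∀ k : ℕ, 1 ≤ k → orderOf ((τ : ZMod (p ^ k))) = Nat.totient (p ^ k)) ∨
    (∀ k : ℕ, 1 ≤ k → orderOf ((h : ZMod (p ^ k))) = Nat.totient (p ^ k)) := by
  have hmod : (τ : ZMod p) * h = 1 := by
    exact_mod_cast (ZMod.natCast_eq_natCast_iff (τ * h) 1 p).mpr hinv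
  have hh : orderOf (h : ZMod p) = p - 1 := by rw [← orderOf_eq_of_mul_eq_one hmod, hτ]
  by_cases hτp : (τ : ZMod (p ^ 2)) ^ (p - 1) = 1
  · refine Or.inr fun k hk ↦ orderOf_natCast_prime_pow_eq_totient hp hp2 hh (fun hhp ↦ ?_) hk
    have hp3 : 2 < p := lt_of_le_of_ne hp.two_le hp2.symm
    obtain ⟨m, hm⟩ := (Nat.modEq_iff_dvd' (Nat.mul_pos hτ1 hh1)).mp hinv.symm
    have hm1 : τ * h = 1 + p * m := by have := Nat.mul_pos hτ1 hh1; omega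
    have hm0 : m ≠ 0 := by
      rintro rfl
      obtain rfl : τ = 1 := Nat.eq_one_of_mul_eq_one_right (by simpa using hm1)
      simp at hτ
      omega
    have hmp : m < p := by
      have hle := Nat.mul_le_mul (hτ2.trans (Nat.sub_le p 1)) (hh2.trans (Nat.sub_le p 1))
      have hlt : p * m < p * p := by omega
      exact Nat.lt_of_mul_lt_mul_left hlt
    have hpm : ¬ (p : ℤ) ∣ (m : ℤ) := by
      exact_mod_cast Nat.not_dvd_of_pos_of_lt (Nat.pos_of_ne_zero hm0) hmp
    have hord := ZMod.orderOf_one_add_mul_prime hp hp2 m hpm 1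
    have hcast : (1 + p * (m : ℤ) : ZMod (p ^ 2)) = τ * h := by
      exact_mod_cast congrArg (Nat.cast : ℕ → ZMod (p ^ 2)) hm1.symm
    have hone : (1 + p * (m : ℤ) : ZMod (p ^ 2)) ^ (p - 1) = 1 := by
      rw [hcast, mul_pow, hτp, hhp, one_mul]
    have hdvd := orderOf_dvd_of_pow_eq_one hone
    rw [hord, pow_one] at hdvd
    exact Nat.not_dvd_of_pos_of_lt (by omega) (by omega) hdvd
  · exact Or.inl fun k hk ↦ orderOf_natCast_prime_pow_eq_totient hp hp2 hτ hτp hk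
end

section
/- Let G be a finite cyclic group of order n, let u ∈ G, and for each divisor d of n let the inner sum run over all homomorphisms (characters) χ : G → ℂˣ whose order in the character group is exactly d. Then (φ(n)/n) · Σ_{d ∣ n} (μ(d)/φ(d)) · Σ_{χ of order d} χ(u) equals 1 if u generates G (i.e. the order of u is n) and equals 0 otherwise. -/
open ArithmeticFunction

theorem sum_divisors_moebius_mul_eq_prod_one_sub {R : Type*} [CommRing R]
    {f : ArithmeticFunction R} (hf : f.IsMultiplicative) {n : ℕ} (hn : n ≠ 0) :
    ∑ k ∈ n.divisors, (moebius k : R) * f k = ∏ p ∈ n.primeFactors, (1 - f p) := by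
  have hr : UniqueFactorizationMonoid.radical n ≠ 0 := UniqueFactorizationMonoid.radical_ne_zero
  have hsub : (UniqueFactorizationMonoid.radical n).divisors ⊆ n.divisors :=
    Nat.divisors_subset_of_dvd hn UniqueFactorizationMonoid.radical_dvd_self
  have h := IsMultiplicative.prodPrimeFactors_one_sub_of_squarefree f hf
    (UniqueFactorizationMonoid.squarefree_radical (a := n))
  rw [← Finset.sum_subset hsub, ← h, Nat.primeFactors_radical]
  intro k hk hk'
  rw [moebius_eq_zero_of_not_squarefree, Int.cast_zero, zero_mul]
  intro hs
  apply hk'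
  rw [Nat.mem_divisors] at hk ⊢
  exact ⟨(UniqueFactorizationMonoid.dvd_radical_iff hs.isRadical hn).2 hk.1, hr⟩

theorem sum_divisors_moebius_div_of_dvd {n d : ℕ} (hn : n ≠ 0) (hd : d ∣ n) :
    ∑ e ∈ n.divisors with d ∣ e, (moebius e : ℂ) / e =
      (n.totient : ℂ) / n * ((moebius d : ℂ) / d.totient) := by
  obtain ⟨m, rfl⟩ := hd
  obtain ⟨hd0, hm0⟩ := mul_ne_zero_iff.1 hn
  let f : ArithmeticFunction ℂ := ⟨fun k => if k.Coprime d then (k : ℂ)⁻¹ else 0, by simp⟩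
  have hfk (k : ℕ) : f k = if k.Coprime d then (k : ℂ)⁻¹ else 0 := rfl
  have hf : f.IsMultiplicative := by
    refine ⟨by simp [hfk], fun {a b} _ => ?_⟩
    simp only [hfk, Nat.coprime_mul_iff_left]
    split_ifs <;> simp_all [mul_comm]
  have hsum : ∑ e ∈ (d * m).divisors with d ∣ e, (moebius e : ℂ) / e =
      (moebius d : ℂ) / d * ∑ k ∈ m.divisors, (moebius k : ℂ) * f k := by
    rw [Finset.mul_sum]
    symm
    refine Finset.sum_bij (fun k _ => d * k) ?_ ?_ ?_ ?_
    · intro k hk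
      simp only [Finset.mem_filter, Nat.mem_divisors] at hk ⊢
      exact ⟨⟨mul_dvd_mul_left d hk.1, hn⟩, dvd_mul_right d k⟩
    · intro a _ b _ h
      exact Nat.eq_of_mul_eq_mul_left (Nat.pos_of_ne_zero hd0) h
    · intro e he
      simp only [Finset.mem_filter, Nat.mem_divisors] at he
      obtain ⟨⟨he, -⟩, k, rfl⟩ := he
      exact ⟨k, Nat.mem_divisors.2
        ⟨Nat.dvd_of_mul_dvd_mul_left (Nat.pos_of_ne_zero hd0) he, hm0⟩, rfl⟩
    · intro k _
      rw [hfk]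
      split_ifs with h
      · rw [isMultiplicative_moebius.map_mul_of_coprime h.symm]
        push_cast
        rw [div_mul_eq_mul_div, div_eq_mul_inv, div_eq_mul_inv, mul_inv]
        ring
      · rw [moebius_eq_zero_of_not_squarefree
          fun hs => h (Nat.coprime_of_squarefree_mul hs).symm]
        simp
  have htot (k : ℕ) : (k.totient : ℂ) = k * ∏ p ∈ k.primeFactors, (1 - (p : ℂ)⁻¹) := by
    simpa using congrArg (Rat.cast : ℚ → ℂ) (Nat.totient_eq_mul_prod_factors k)
  have hprod : (∏ p ∈ m.primeFactors, (1 - f p)) * ∏ p ∈ d.primeFactors, (1 - (p : ℂ)⁻¹) =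
      ∏ p ∈ (d * m).primeFactors, (1 - (p : ℂ)⁻¹) := by
    rw [Nat.primeFactors_mul hd0 hm0, ← Finset.sdiff_union_self_eq_union.trans
      (Finset.union_comm _ _), Finset.prod_union Finset.sdiff_disjoint]
    congr 1
    rw [← Finset.prod_subset Finset.sdiff_subset]
    · refine Finset.prod_congr rfl fun p hp => ?_
      simp only [Finset.mem_sdiff, Nat.mem_primeFactors] at hp
      rw [hfk, if_pos ((Nat.Prime.coprime_iff_not_dvd hp.1.1).2 fun h => hp.2 ⟨hp.1.1, h, hd0⟩)]
    · intro p hp hp'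
      simp only [Finset.mem_sdiff, Nat.mem_primeFactors] at hp hp'
      rw [hfk, if_neg, sub_zero]
      rw [Nat.Prime.coprime_iff_not_dvd hp.1]
      tauto
  have hdt : (d.totient : ℂ) ≠ 0 := by simpa using hd0
  have hdC : (d : ℂ) ≠ 0 := Nat.cast_ne_zero.2 hd0
  have hnC : ((d * m : ℕ) : ℂ) ≠ 0 := Nat.cast_ne_zero.2 hn
  rw [htot d] at hdt
  rw [hsum, sum_divisors_moebius_mul_eq_prod_one_sub hf hm0, htot (d * m), htot d, ← hprod,
    mul_div_cancel_left₀ _ hnC]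
  have hP := right_ne_zero_of_mul hdt
  generalize ∏ p ∈ d.primeFactors, (1 - (p : ℂ)⁻¹) = P at hP ⊢
  field_simp

theorem sum_moebius_of_dvd_div {n m : ℕ} (hn : n ≠ 0) (hm : m ∣ n) :
    ∑ e ∈ n.divisors with m ∣ n / e, (moebius e : ℂ) = if m = n then 1 else 0 := by
  obtain ⟨k, rfl⟩ := hm
  obtain ⟨hm0, hk0⟩ := mul_ne_zero_iff.1 hn
  have : {e ∈ (m * k).divisors | m ∣ m * k / e} = k.divisors := by
    ext e
    simp only [Finset.mem_filter, Nat.mem_divisors]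
    constructor
    · rintro ⟨⟨he, -⟩, h⟩
      rw [Nat.dvd_div_iff_mul_dvd he, mul_comm e] at h
      exact ⟨Nat.dvd_of_mul_dvd_mul_left (Nat.pos_of_ne_zero hm0) h, hk0⟩
    · rintro ⟨he, -⟩
      have he' := he.mul_left m
      exact ⟨⟨he', hn⟩, by
        rw [Nat.dvd_div_iff_mul_dvd he', mul_comm e]; exact mul_dvd_mul_left m he⟩
  rw [this]
  rw [← Int.cast_sum, ← coe_mul_zeta_apply, moebius_mul_coe_zeta, one_apply]
  simp [hm0]

theorem IsCyclic.pow_card_div_eq_one_iff {G : Type*} [CommGroup G] [IsCyclic G] [Finite G]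
    {e : ℕ} (he : e ∣ Nat.card G) (u : G) :
    u ^ (Nat.card G / e) = 1 ↔ ∃ v, v ^ e = u := by
  obtain ⟨k, hk⟩ := he
  have hc : Nat.card G ≠ 0 := Nat.card_pos.ne'
  have he0 : 0 < e := Nat.pos_of_ne_zero (by rintro rfl; simp [hk] at hc)
  rw [hk, Nat.mul_div_cancel_left _ he0]
  constructor
  · intro h
    obtain ⟨g, hg⟩ := IsCyclic.exists_generator (α := G)
    obtain ⟨j, rfl⟩ := (mem_powers_iff_mem_zpowers (x := g)).2 (hg u)
    have hk0 : 0 < k := Nat.pos_of_ne_zero (by rintro rfl; simp [hk] at hc)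
    simp only [← pow_mul] at h ⊢
    rw [← orderOf_dvd_iff_pow_eq_one, orderOf_eq_card_of_forall_mem_zpowers hg, hk] at h
    obtain ⟨i, rfl⟩ := Nat.dvd_of_mul_dvd_mul_right hk0 h
    exact ⟨g ^ i, by rw [← pow_mul, mul_comm]⟩
  · rintro ⟨v, rfl⟩
    rw [← pow_mul, ← hk, pow_card_eq_one']

theorem IsCyclic.card_orderOf_dvd {H : Type*} [Group H] [IsCyclic H] [Fintype H] {e : ℕ}
    (he : e ∣ Nat.card H) : Finset.card {x : H | orderOf x ∣ e} = e := by
  classical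
  have he0 : e ≠ 0 := ne_zero_of_dvd_ne_zero Nat.card_pos.ne' he
  have hsum : ∑ d ∈ e.divisors, Finset.card {x : H | orderOf x = d} = e := by
    conv_rhs => rw [← Nat.sum_totient e]
    refine Finset.sum_congr rfl fun d hd => IsCyclic.card_orderOf_eq_totient ?_
    rw [← Nat.card_eq_fintype_card]
    exact (Nat.dvd_of_mem_divisors hd).trans he
  rw [sum_card_orderOf_eq_card_pow_eq_one he0] at hsum
  convert hsum using 3
  exact orderOf_dvd_iff_pow_eq_one

theorem orderOf_mul_dvd_iff_of_orderOf_dvd {H : Type*} [CommGroup H] {x : H} {e : ℕ}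
    (hx : orderOf x ∣ e) (y : H) : orderOf (x * y) ∣ e ↔ orderOf y ∣ e := by
  rw [orderOf_dvd_iff_pow_eq_one] at hx
  simp only [orderOf_dvd_iff_pow_eq_one, mul_pow, hx, one_mul]

theorem orderOf_pow_card_div_dvd {H : Type*} [Group H] (x : H) {e : ℕ} (he : e ∣ Nat.card H) :
    orderOf (x ^ (Nat.card H / e)) ∣ e := by
  rw [orderOf_dvd_iff_pow_eq_one, ← pow_mul, Nat.div_mul_cancel he, pow_card_eq_one']

theorem sum_monoidHom_orderOf_dvd {G : Type*} [CommGroup G] [IsCyclic G] [Finite G]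
    [Fintype (G →* ℂˣ)] {e : ℕ} (he : e ∣ Nat.card G) (u : G) :
    ∑ χ : G →* ℂˣ with orderOf χ ∣ e, ((χ u : ℂˣ) : ℂ) =
      if orderOf u ∣ Nat.card G / e then (e : ℂ) else 0 := by
  have : NeZero (Nat.card G) := ⟨Nat.card_pos.ne'⟩
  have : NeZero (Monoid.exponent G) := ⟨Monoid.exponent_ne_zero_of_finite⟩
  obtain ⟨E⟩ := IsCyclic.monoidHom_equiv_self G ℂ
  have hcard : Nat.card (G →* ℂˣ) = Nat.card G := Nat.card_congr E.toEquiv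
  have : IsCyclic (G →* ℂˣ) := isCyclic_of_surjective E.symm E.symm.surjective
  split_ifs with h <;> rw [orderOf_dvd_iff_pow_eq_one] at h
  · obtain ⟨v, rfl⟩ := (IsCyclic.pow_card_div_eq_one_iff he u).1 h
    rw [Finset.sum_congr rfl (g := fun _ => (1 : ℂ))]
    · rw [Finset.sum_const, nsmul_one, IsCyclic.card_orderOf_dvd (hcard ▸ he)]
    · intro χ hχ
      have hχe : χ ^ e = 1 := orderOf_dvd_iff_pow_eq_one.1 (Finset.mem_filter.1 hχ).2
      rw [map_pow, ← MonoidHom.pow_apply, hχe, MonoidHom.one_apply, Units.val_one]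
  · obtain ⟨χ, hχ⟩ := CommGroup.exists_apply_ne_one_of_hasEnoughRootsOfUnity G ℂ h
    obtain ⟨ψ, hψe, hψu⟩ : ∃ ψ : G →* ℂˣ, orderOf ψ ∣ e ∧ ((ψ u : ℂˣ) : ℂ) ≠ 1 := by
      refine ⟨χ ^ (Nat.card G / e), hcard ▸ orderOf_pow_card_div_dvd χ (hcard ▸ he), ?_⟩
      rw [map_pow] at hχ
      simpa [Units.ext_iff] using hχ
    refine eq_zero_of_mul_eq_self_left hψu ?_
    rw [Finset.mul_sum]
    refine Finset.sum_bijective (ψ * ·) (Group.mulLeft_bijective ψ) ?_ ?_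
    · intro χ
      simp only [Finset.mem_filter, Finset.mem_univ, true_and]
      exact (orderOf_mul_dvd_iff_of_orderOf_dvd hψe χ).symm
    · intro χ _
      simp

/-- Let `G` be a finite cyclic group of order `n` and `u ∈ G`. Then
`(φ(n)/n) · Σ_{d ∣ n} (μ(d)/φ(d)) · Σ_{χ : G →* ℂˣ of order d} χ(u)` equals `1` if `u`
generates `G` (i.e. `orderOf u = n`) and `0` otherwise. -/
theorem characteristic_function_of_generators (G : Type*) [CommGroup G] [Fintype G]
    (hG : IsCyclic G) (u : G) :
    ((Nat.totient (Fintype.card G) : ℂ) / (Fintype.card G : ℂ)) *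
      ∑ d ∈ (Fintype.card G).divisors,
        ((moebius d : ℂ) / (Nat.totient d : ℂ)) *
          ∑ᶠ χ : {χ : G →* ℂˣ // orderOf χ = d}, ((χ.1 u : ℂˣ) : ℂ) =
    (if orderOf u = Fintype.card G then 1 else 0) := by
  classical
  have : NeZero (Monoid.exponent G) := ⟨Monoid.exponent_ne_zero_of_finite⟩
  have := Fintype.ofFinite (G →* ℂˣ)
  set n := Fintype.card G
  have hnG : Nat.card G = n := Nat.card_eq_fintype_card
  have hn0 : n ≠ 0 := Fintype.card_ne_zero
  have hfin (d : ℕ) : ∑ᶠ χ : {χ : G →* ℂˣ // orderOf χ = d}, ((χ.1 u : ℂˣ) : ℂ) =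
      ∑ χ : G →* ℂˣ with orderOf χ = d, ((χ u : ℂˣ) : ℂ) := by
    rw [finsum_eq_sum_of_fintype]
    exact (Finset.sum_subtype _ (by simp) fun χ : G →* ℂˣ => ((χ u : ℂˣ) : ℂ)).symm
  have hpow {e : ℕ} (he : e ∈ n.divisors) :
      ∑ d ∈ n.divisors with d ∣ e, ∑ χ : G →* ℂˣ with orderOf χ = d, ((χ u : ℂˣ) : ℂ) =
        if orderOf u ∣ n / e then (e : ℂ) else 0 := by
    have hen := Nat.dvd_of_mem_divisors he
    rw [← hnG, ← sum_monoidHom_orderOf_dvd (hnG ▸ hen) u, hnG,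
      Nat.divisors_filter_dvd_of_dvd hn0 hen,
      ← Finset.sum_fiberwise_of_maps_to (s := {χ : G →* ℂˣ | orderOf χ ∣ e}) (t := e.divisors)
        (g := orderOf)]
    · refine Finset.sum_congr rfl fun d hd => Finset.sum_congr ?_ fun _ _ => rfl
      ext χ
      simp only [Finset.mem_filter, Finset.mem_univ, true_and]
      exact ⟨fun h => ⟨h.symm ▸ Nat.dvd_of_mem_divisors hd, h⟩, And.right⟩
    · intro χ hχ
      rw [Finset.mem_filter] at hχ
      exact Nat.mem_divisors.2
        ⟨hχ.2, ne_zero_of_dvd_ne_zero hn0 hen⟩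
  calc
    _ = ∑ d ∈ n.divisors, ∑ e ∈ n.divisors with d ∣ e, (moebius e : ℂ) / e *
          ∑ χ : G →* ℂˣ with orderOf χ = d, ((χ u : ℂˣ) : ℂ) := by
      rw [Finset.mul_sum]
      refine Finset.sum_congr rfl fun d hd => ?_
      rw [← Finset.sum_mul, sum_divisors_moebius_div_of_dvd hn0 (Nat.dvd_of_mem_divisors hd),
        hfin, mul_assoc]
    _ = ∑ e ∈ n.divisors, (moebius e : ℂ) / e *
          ∑ d ∈ n.divisors with d ∣ e,
            ∑ χ : G →* ℂˣ with orderOf χ = d, ((χ u : ℂˣ) : ℂ) := by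
      simp_rw [Finset.mul_sum (n.divisors.filter _)]
      refine Finset.sum_comm' fun d e => ?_
      simp only [Finset.mem_filter]
      tauto
    _ = ∑ e ∈ n.divisors with orderOf u ∣ n / e, (moebius e : ℂ) := by
      rw [Finset.sum_filter]
      refine Finset.sum_congr rfl fun e he => ?_
      have : (e : ℂ) ≠ 0 := Nat.cast_ne_zero.2 (Nat.pos_of_mem_divisors he).ne'
      rw [hpow he]
      split_ifs <;> simp [this]
    _ = _ := sum_moebius_of_dvd_div hn0 orderOf_dvd_card
end
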